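/- Let P be a compact convex subset of the Euclidean plane with P = -P, containing the closed unit disk centered at the origin, such that the point (0, 1) lies on the frontier of P, and such that for some real t > 1 both points (t, 0) and (-t, 0) lie in the topological interior of P. Then there exist h ∈ [1/2, 1] and θ ∈ [-π/2, π/2] with sin²θ ≥ 3/4 such that the closed elliptical region E = {x ∈ ℝ² : 4x₁²/t² + x₂²/h² ≤ 1} (semi-axes t/2 and h) satisfies E ⊆ P and the point ((t/2)·cos θ, h·sin θ) lies on the frontier of P. -/

import Mathlib

open Real

/-- The point in the Euclidean plane with coordinates `(a, b)`. -/
noncomputable def pt (a b : ℝ) : EuclideanSpace ℝ (Fin 2) :=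
  (WithLp.equiv 2 (Fin 2 → ℝ)).symm ![a, b]

@[simp]
theorem pt_apply_zero (a b : ℝ) : pt a b 0 = a := rfl

@[simp]
theorem pt_apply_one (a b : ℝ) : pt a b 1 = b := rfl

theorem pt_eta (x : EuclideanSpace ℝ (Fin 2)) : pt (x 0) (x 1) = x := by
  ext i
  fin_cases i <;> rfl

theorem neg_pt (a b : ℝ) : -pt a b = pt (-a) (-b) := by
  ext i
  fin_cases i <;> rfl

theorem pt_eq_smul_add_smul (a b : ℝ) : pt a b = a • pt 1 0 + b • pt 0 1 := by
  ext i
  fin_cases i <;> simp [pt]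

@[fun_prop]
theorem Continuous.pt {X : Type*} [TopologicalSpace X] {f g : X → ℝ} (hf : Continuous f)
    (hg : Continuous g) : Continuous fun x => _root_.pt (f x) (g x) := by
  have h : (fun x => _root_.pt (f x) (g x)) =
      fun x => f x • _root_.pt 1 0 + g x • _root_.pt 0 1 :=
    funext fun x => pt_eq_smul_add_smul (f x) (g x)
  rw [h]
  fun_prop

theorem norm_pt (a b : ℝ) : ‖pt a b‖ = √(a ^ 2 + b ^ 2) := by
  simp [EuclideanSpace.norm_eq, Fin.sum_univ_two]

/-- A convex set with nonempty interior has a supporting functional at every point outside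
its interior. -/
theorem Convex.exists_forall_le_of_notMem_interior {E : Type*} [AddCommGroup E]
    [TopologicalSpace E] [IsTopologicalAddGroup E] [Module ℝ E] [ContinuousSMul ℝ E]
    {s : Set E} (hs : Convex ℝ s) (hne : (interior s).Nonempty) {q : E} (hq : q ∉ interior s) :
    ∃ f : StrongDual ℝ E, (∀ x ∈ interior s, f x < f q) ∧ ∀ x ∈ s, f x ≤ f q := by
  obtain ⟨f, hf⟩ := geometric_hahn_banach_open_point hs.interior isOpen_interior hq
  refine ⟨f, hf, fun x hx => ?_⟩
  have hx' : x ∈ closure (interior s) := by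
    rw [hs.closure_interior_eq_closure_of_nonempty_interior hne]
    exact subset_closure hx
  exact closure_minimal (fun y hy => (hf y hy).le)
    (isClosed_le f.continuous continuous_const) hx'

/-- If a linear form on the closed unit disk attains a positive maximum at `(u, v)`, then
`(u, v)` is a unit vector and the form is a multiple of the inner product with it. -/
theorem sq_add_sq_eq_one_of_forall_disk_le {A B u v : ℝ} (huv : u ^ 2 + v ^ 2 ≤ 1)
    (hpos : 0 < A * u + B * v)
    (hmax : ∀ x y : ℝ, x ^ 2 + y ^ 2 ≤ 1 → A * x + B * y ≤ A * u + B * v) :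
    u ^ 2 + v ^ 2 = 1 ∧ A = (A * u + B * v) * u := by
  set M := A * u + B * v with hM
  have hAB : 0 < A ^ 2 + B ^ 2 := by
    by_contra! h
    have hA : A = 0 := by nlinarith [sq_nonneg A, sq_nonneg B]
    have hB : B = 0 := by nlinarith [sq_nonneg A, sq_nonneg B]
    simp [hM, hA, hB] at hpos
  set N := √(A ^ 2 + B ^ 2) with hN
  have hN0 : 0 < N := Real.sqrt_pos.2 hAB
  have hN2 : N ^ 2 = A ^ 2 + B ^ 2 := Real.sq_sqrt hAB.le
  have hNM : N ≤ M := by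
    have h := hmax (A / N) (B / N) (by
      rw [div_pow, div_pow, ← add_div, ← hN2, div_self (by positivity)])
    have h' : A * (A / N) + B * (B / N) = N := by
      field_simp
      linarith
    linarith
  have hM2 : A ^ 2 + B ^ 2 ≤ M ^ 2 := by
    rw [← hN2]
    gcongr
  have hlagrange : M ^ 2 + (A * v - B * u) ^ 2 = (A ^ 2 + B ^ 2) * (u ^ 2 + v ^ 2) := by
    rw [hM]
    ring
  have hunit : u ^ 2 + v ^ 2 = 1 := by
    refine le_antisymm huv ?_
    by_contra! h
    nlinarith [sq_nonneg (A * v - B * u), mul_pos hAB (sub_pos.2 h)]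
  have hcross : A * v - B * u = 0 := by
    rw [hunit] at hlagrange
    nlinarith [sq_nonneg (A * v - B * u)]
  refine ⟨hunit, ?_⟩
  rw [hM]
  linear_combination (-A) * hunit + v * hcross

/-- A point of an inscribed ellipse with semi-axes `t / 2` and `h` that is not interior to a
convex set containing `(±t, 0)` has parameter `(u, v)` on the unit circle with `|u| ≤ 1 / 2`. -/
theorem Convex.ellipse_contact_parameter {P : Set (EuclideanSpace ℝ (Fin 2))}
    (hP : Convex ℝ P) (h0 : 0 ∈ interior P) {t h : ℝ} (hp : pt t 0 ∈ P) (hm : pt (-t) 0 ∈ P)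
    (hE : ∀ x y : ℝ, x ^ 2 + y ^ 2 ≤ 1 → pt (t / 2 * x) (h * y) ∈ P) {u v : ℝ}
    (huv : u ^ 2 + v ^ 2 ≤ 1) (hq : pt (t / 2 * u) (h * v) ∉ interior P) :
    u ^ 2 + v ^ 2 = 1 ∧ |u| ≤ 1 / 2 := by
  obtain ⟨f, hf0, hf⟩ := hP.exists_forall_le_of_notMem_interior ⟨0, h0⟩ hq
  have hfpt (a b : ℝ) : f (pt a b) = a * f (pt 1 0) + b * f (pt 0 1) := by
    rw [pt_eq_smul_add_smul a b]
    simp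
  obtain ⟨A, hA⟩ : ∃ A, A = t / 2 * f (pt 1 0) := ⟨_, rfl⟩
  obtain ⟨B, hB⟩ : ∃ B, B = h * f (pt 0 1) := ⟨_, rfl⟩
  have hval (x y : ℝ) : f (pt (t / 2 * x) (h * y)) = A * x + B * y := by
    rw [hfpt, hA, hB]
    ring
  have hpos := hf0 0 h0
  have hright := hf _ hp
  have hleft := hf _ hm
  rw [map_zero, hval] at hpos
  rw [hfpt, hval] at hright hleft
  have hmax (x y : ℝ) (hxy : x ^ 2 + y ^ 2 ≤ 1) : A * x + B * y ≤ A * u + B * v := by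
    rw [← hval, ← hval]
    exact hf _ (hE x y hxy)
  obtain ⟨hunit, hAu⟩ := sq_add_sq_eq_one_of_forall_disk_le huv hpos hmax
  refine ⟨hunit, abs_le.2 ⟨?_, ?_⟩⟩
  · refine le_of_mul_le_mul_left ?_ hpos
    linarith
  · refine le_of_mul_le_mul_left ?_ hpos
    linarith

/-- Increasing the vertical semi-axis of an ellipse inscribed in a closed set from `1 / 2`,
one reaches either semi-axis `1` or an ellipse that meets the complement of the interior. -/
theorem IsClosed.exists_ellipse_subset_of_notMem_interior
    {P : Set (EuclideanSpace ℝ (Fin 2))} (hP : IsClosed P) (h1 : pt 0 1 ∉ interior P) {r : ℝ}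
    (hE : ∀ x y : ℝ, x ^ 2 + y ^ 2 ≤ 1 → pt (r * x) (1 / 2 * y) ∈ P) :
    ∃ h u v : ℝ, 1 / 2 ≤ h ∧ h ≤ 1 ∧ u ^ 2 + v ^ 2 ≤ 1 ∧
      (∀ x y : ℝ, x ^ 2 + y ^ 2 ≤ 1 → pt (r * x) (h * y) ∈ P) ∧
      pt (r * u) (h * v) ∉ interior P := by
  let S : Set ℝ := Set.Icc (1 / 2) 1 ∩
    {h | ∀ x y : ℝ, x ^ 2 + y ^ 2 ≤ 1 → pt (r * x) (h * y) ∈ P}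
  have hS : IsCompact S := by
    refine isCompact_Icc.inter_right ?_
    simp only [Set.ofPred_forall]
    exact isClosed_iInter fun x => isClosed_iInter fun y => isClosed_iInter fun _ =>
      hP.preimage (by fun_prop)
  obtain ⟨h, ⟨⟨hl, hu⟩, hh⟩, hmax⟩ := hS.exists_isGreatest ⟨1 / 2, by norm_num, hE⟩
  by_contra! hint
  have hint' := hint h
  obtain rfl | hlt := hu.eq_or_lt
  · exact h1 (by simpa using hint' 0 1 hl le_rfl (by norm_num) hh)
  have hK : IsCompact {p : ℝ × ℝ | p.1 ^ 2 + p.2 ^ 2 ≤ 1} := by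
    refine (isCompact_Icc (a := ((-1, -1) : ℝ × ℝ)) (b := (1, 1))).of_isClosed_subset
      (_root_.isClosed_le (by fun_prop) continuous_const) ?_
    rintro ⟨x, y⟩ (hxy : x ^ 2 + y ^ 2 ≤ 1)
    have hx : |x| ≤ 1 := by
      rw [← sq_le_one_iff_abs_le_one]
      nlinarith [sq_nonneg y]
    have hy : |y| ≤ 1 := by
      rw [← sq_le_one_iff_abs_le_one]
      nlinarith [sq_nonneg x]
    exact ⟨⟨(abs_le.1 hx).1, (abs_le.1 hy).1⟩, ⟨(abs_le.1 hx).2, (abs_le.1 hy).2⟩⟩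
  have hnear : ∀ᶠ k in nhds h, ∀ p ∈ {p : ℝ × ℝ | p.1 ^ 2 + p.2 ^ 2 ≤ 1},
      pt (r * p.1) (k * p.2) ∈ interior P := by
    refine hK.eventually_forall_of_forall_eventually fun p hp => ?_
    have hc : Continuous fun z : ℝ × (ℝ × ℝ) => pt (r * z.2.1) (z.1 * z.2.2) := by fun_prop
    exact hc.continuousAt.eventually (isOpen_interior.mem_nhds (hint' p.1 p.2 hl hu hp hh))
  obtain ⟨k, hk, hhk, hk1⟩ := ((hnear.filter_mono nhdsWithin_le_nhds).and
    (Ioc_mem_nhdsGT hlt)).exists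
  exact hhk.not_ge (hmax ⟨⟨hl.trans hhk.le, hk1⟩,
    fun x y hxy => interior_subset (hk (x, y) hxy)⟩)

/-- Planar core of the Chou–Wang lemma: if an origin-symmetric compact convex plane set
`P` contains the closed unit disk, has `(0,1)` on its boundary and `(±t, 0)` (with
`t > 1`) in its interior, then there is an ellipse with semi-axes `t/2` and `h ∈ [1/2,1]`
contained in `P` touching the boundary of `P` at a point with parameter angle `θ`
satisfying `sin² θ ≥ 3/4`. -/
theorem chou_wang_planar_core (P : Set (EuclideanSpace ℝ (Fin 2)))
    (hPc : IsCompact P) (hPconv : Convex ℝ P) (hPsym : P = -P)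
    (hball : Metric.closedBall (0 : EuclideanSpace ℝ (Fin 2)) 1 ⊆ P)
    (hfront : pt 0 1 ∈ frontier P)
    (t : ℝ) (ht : 1 < t)
    (hp : pt t 0 ∈ interior P) (hm : pt (-t) 0 ∈ interior P) :
    ∃ h θ : ℝ, 1 / 2 ≤ h ∧ h ≤ 1 ∧ -(π / 2) ≤ θ ∧ θ ≤ π / 2 ∧ Real.sin θ ^ 2 ≥ 3 / 4 ∧
      {x : EuclideanSpace ℝ (Fin 2) | 4 * (x 0) ^ 2 / t ^ 2 + (x 1) ^ 2 / h ^ 2 ≤ 1} ⊆ P ∧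
      pt (t / 2 * Real.cos θ) (h * Real.sin θ) ∈ frontier P := by
  have h0 : (0 : EuclideanSpace ℝ (Fin 2)) ∈ interior P :=
    interior_mono hball (Metric.ball_subset_interior_closedBall (Metric.mem_ball_self one_pos))
  have htP := interior_subset hp
  have hmtP := interior_subset hm
  have hhalf (x y : ℝ) (hxy : x ^ 2 + y ^ 2 ≤ 1) : pt (t / 2 * x) (1 / 2 * y) ∈ P := by
    have hx : |x| ≤ 1 := by
      rw [← sq_le_one_iff_abs_le_one]
      nlinarith [sq_nonneg y]
    have hxP : pt (t * x) 0 ∈ P := by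
      have := hPconv htP hmtP (a := (1 + x) / 2) (b := (1 - x) / 2)
        (by linarith [(abs_le.1 hx).1]) (by linarith [(abs_le.1 hx).2]) (by ring)
      convert this using 1
      rw [pt_eq_smul_add_smul, pt_eq_smul_add_smul t, pt_eq_smul_add_smul (-t)]
      module
    have hyP : pt 0 y ∈ P := by
      refine hball ?_
      rw [mem_closedBall_zero_iff, norm_pt, Real.sqrt_le_one]
      nlinarith [sq_nonneg x]
    have := hPconv hxP hyP (a := 1 / 2) (b := 1 / 2) (by norm_num) (by norm_num) (by norm_num)
    convert this using 1
    rw [pt_eq_smul_add_smul, pt_eq_smul_add_smul (t * x), pt_eq_smul_add_smul 0 y]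
    module
  obtain ⟨h, u, v, hl, hu, huv, hE, hq⟩ :=
    hPc.isClosed.exists_ellipse_subset_of_notMem_interior hfront.2 hhalf
  obtain ⟨hunit, hu2⟩ := hPconv.ellipse_contact_parameter h0 htP hmtP hE huv hq
  have hcontact : ∃ v' : ℝ, |u| ^ 2 + v' ^ 2 = 1 ∧ pt (t / 2 * |u|) (h * v') ∉ interior P := by
    rcases abs_choice u with hab | hab <;> rw [hab]
    · exact ⟨v, hunit, hq⟩
    · refine ⟨-v, by linarith [hunit], fun hmem => hq ?_⟩
      have hneg : -pt (t / 2 * -u) (h * -v) ∈ interior P := by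
        rw [hPsym]
        refine preimage_interior_subset_interior_preimage continuous_neg ?_
        rwa [Set.mem_preimage, neg_neg]
      simpa [neg_pt] using hneg
  obtain ⟨w, hw, hqw⟩ := hcontact
  have hw1 : |w| ≤ 1 := by
    rw [← sq_le_one_iff_abs_le_one]
    nlinarith [sq_nonneg |u|]
  have hsin : Real.sin (Real.arcsin w) = w :=
    Real.sin_arcsin (abs_le.1 hw1).1 (abs_le.1 hw1).2
  have hcos : Real.cos (Real.arcsin w) = |u| := by
    rw [Real.cos_arcsin, ← hw, add_sub_cancel_right, Real.sqrt_sq (abs_nonneg u)]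
  refine ⟨h, Real.arcsin w, hl, hu, Real.neg_pi_div_two_le_arcsin w,
    Real.arcsin_le_pi_div_two w, ?_, fun x hx => ?_, ?_⟩
  · rw [hsin]
    nlinarith [abs_nonneg u]
  · have := hE (2 * x 0 / t) (x 1 / h) (by
      rw [div_pow, div_pow, mul_pow]
      norm_num
      exact hx)
    rw [← pt_eta x]
    convert this using 2 <;> field_simp
  · rw [hsin, hcos]
    exact ⟨subset_closure (hE _ _ hw.le), hqw⟩
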